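/- arXiv:1603.02020 — 3 statements merged into one kernel-verified Lean document; each statement's English description precedes it below -/
import Mathlib

section
/- Let t_1,…,t_M ∈ [0,1)^d and q > 0 be such that sep := min_{r∈ℤ^d, j≠ℓ} ‖t_j − t_ℓ + r‖_∞ > q. If n ∈ ℕ₀ satisfies n > √d / q, then the Fourier–Vandermonde matrix F_n = (e^{2πi k·t_j})_{j=1,…,M; k∈{0,…,n}^d} ∈ ℂ^{M×(n+1)^d} has full rank M. -/
open Matrix

/-- The multivariate Vandermonde (nonequispaced Fourier) matrix
`F_n = (e^{2πi k·t_j})_{j=1,…,M; k∈{0,…,n}^d}`. -/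
noncomputable def fourierMatrix {M : ℕ} (d : ℕ) (t : Fin M → Fin d → ℝ) (m : ℕ) :
    Matrix (Fin M) (Fin d → Fin (m + 1)) ℂ :=
  Matrix.of fun j k =>
    Complex.exp (2 * Real.pi * Complex.I * ∑ i, ((k i : ℕ) : ℂ) * (t j i : ℂ))

open MeasureTheory ComplexConjugate

/-- **Parseval's identity**, polarized: the inner product of two square integrable functions on
`(a, b]` in terms of their Fourier coefficients. -/
theorem hasSum_conj_fourierCoeffOn_mul {a b : ℝ} {f g : ℝ → ℂ} (hab : a < b)
    (hf : MemLp f 2 (volume.restrict (Set.Ioc a b)))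
    (hg : MemLp g 2 (volume.restrict (Set.Ioc a b))) :
    HasSum (fun k : ℤ => conj (fourierCoeffOn hab f k) * fourierCoeffOn hab g k)
      ((b - a)⁻¹ • ∫ x in a..b, conj (f x) * g x) := by
  have := Fact.mk (by linarith : 0 < b - a)
  rw [← add_sub_cancel a b] at hf hg
  have hf' := hf.memLp_liftIoc.haarAddCircle
  have hg' := hg.memLp_liftIoc.haarAddCircle
  have h := (fourierBasis (T := b - a)).hasSum_inner_mul_inner hf'.toLp hg'.toLp
  have hk : ∀ k : ℤ, inner ℂ hf'.toLp (fourierBasis k) * inner ℂ (fourierBasis k) hg'.toLp =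
      conj (fourierCoeffOn hab f k) * fourierCoeffOn hab g k := by
    intro k
    rw [← HilbertBasis.repr_apply_apply, ← inner_conj_symm, ← HilbertBasis.repr_apply_apply,
      fourierBasis_repr, fourierBasis_repr, fourierCoeff_congr_ae hf'.coeFn_toLp,
      fourierCoeff_congr_ae hg'.coeFn_toLp]
    rfl
  have hI : inner ℂ hf'.toLp hg'.toLp = (b - a)⁻¹ • ∫ x in a..b, conj (f x) * g x := by
    rw [L2.inner_def]
    have hb : ∫ x in a..b, conj (f x) * g x = ∫ x in a..a + (b - a), conj (f x) * g x := by
      rw [add_sub_cancel]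
    rw [hb, ← AddCircle.integral_liftIoc_eq_intervalIntegral, ← AddCircle.integral_haarAddCircle]
    apply integral_congr_ae
    filter_upwards [hf'.coeFn_toLp, hg'.coeFn_toLp] with x hx hx'
    rw [hx, hx', RCLike.inner_apply, mul_comm]
    rfl
  rw [hI] at h
  simpa only [hk] using h

theorem summable_prod_pi_of_nonneg {d : ℕ} {β : Type*} {f : Fin d → β → ℝ}
    (h0 : ∀ i b, 0 ≤ f i b) (hf : ∀ i, Summable (f i)) :
    Summable fun k : Fin d → β => ∏ i, f i (k i) := by
  induction d with
  | zero => exact Summable.of_finite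
  | succ d ih =>
    rw [← (Fin.consEquiv fun _ : Fin (d + 1) => β).summable_iff]
    convert (hf 0).mul_of_nonneg (ih (fun i => h0 i.succ) fun i => hf i.succ) (h0 0)
      (fun k => Finset.prod_nonneg fun i _ => h0 i.succ (k i)) using 2 with x
    simp [Fin.consEquiv, Fin.prod_univ_succ]

/-- A finite product of absolutely convergent series, as a series over multi-indices. -/
theorem hasSum_prod_pi_of_summable_norm {d : ℕ} {β R : Type*} [NormedField R] [CompleteSpace R]
    {f : Fin d → β → R} {a : Fin d → R} (hf : ∀ i, Summable fun b => ‖f i b‖)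
    (ha : ∀ i, HasSum (f i) (a i)) :
    HasSum (fun k : Fin d → β => ∏ i, f i (k i)) (∏ i, a i) := by
  induction d with
  | zero => simp [hasSum_unique]
  | succ d ih =>
    rw [← (Fin.consEquiv fun _ : Fin (d + 1) => β).hasSum_iff, Fin.prod_univ_succ]
    have hs : Summable fun k : Fin d → β => ‖∏ i, f i.succ (k i)‖ := by
      simpa only [norm_prod] using
        summable_prod_pi_of_nonneg (fun i b => norm_nonneg (f i.succ b)) fun i => hf i.succ
    have hm := summable_mul_of_summable_norm (hf 0) hs
    have ht := ih (fun i => hf i.succ) fun i => ha i.succ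
    have h := (ha 0).mul ht hm
    have he : (fun k : Fin (d + 1) → β => ∏ i, f i (k i)) ∘ Fin.consEquiv (fun _ => β) =
        fun x : β × (Fin d → β) => f 0 x.1 * ∏ i, f i.succ (x.2 i) := by
      ext x
      simp [Fin.consEquiv, Fin.prod_univ_succ]
    rw [he]
    exact h

/-- The Fourier transform at `β` of a function `v` truncated to `[-q / 2, q / 2]`. -/
noncomputable def windowTransform (q : ℝ) (v : ℝ → ℂ) (β : ℝ) : ℂ :=
  ∫ x in (-(q / 2))..(q / 2), Complex.exp (-(2 * Real.pi * Complex.I * (β * x))) * v x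

/-- The function `v` truncated to a window of length `q`, translated to be centred at `s` and
modulated by the frequency `α`. -/
noncomputable def modulatedWindow (q α : ℝ) (v : ℝ → ℂ) (s : ℝ) : ℝ → ℂ :=
  (Set.Ioc (s - q / 2) (s + q / 2)).indicator fun x =>
    Complex.exp (2 * Real.pi * Complex.I * (α * x)) * v (x - s)

theorem memLp_modulatedWindow (q α : ℝ) {v : ℝ → ℂ} (hv : Continuous v) (s : ℝ) (S : Set ℝ) :
    MemLp (modulatedWindow q α v s) 2 (volume.restrict S) := by
  refine MemLp.restrict S ?_
  rw [modulatedWindow, memLp_indicator_iff_restrict measurableSet_Ioc]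
  have hc : Continuous fun x : ℝ =>
      Complex.exp (2 * Real.pi * Complex.I * (α * x)) * v (x - s) := by fun_prop
  obtain ⟨C, hC⟩ := isCompact_Icc.exists_bound_of_continuousOn
    (s := Set.Icc (s - q / 2) (s + q / 2)) hc.continuousOn
  exact MemLp.of_bound hc.aestronglyMeasurable C <|
    ae_restrict_of_forall_mem measurableSet_Ioc fun x hx => hC x (Set.Ioc_subset_Icc_self hx)

theorem intervalIntegral_indicator_Ioc {E : Type*} [NormedAddCommGroup E] [NormedSpace ℝ E]
    {a b c d : ℝ} (hac : a ≤ c) (hcd : c ≤ d) (hdb : d ≤ b)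
    (f : ℝ → E) :
    ∫ x in a..b, (Set.Ioc c d).indicator f x = ∫ x in c..d, f x := by
  rw [intervalIntegral.integral_of_le (hac.trans (hcd.trans hdb)),
    intervalIntegral.integral_of_le hcd, setIntegral_indicator measurableSet_Ioc,
    Set.inter_eq_right.2 (Set.Ioc_subset_Ioc hac hdb)]

theorem fourierCoeffOn_modulatedWindow {q s : ℝ} (hq : 0 < q) (hs : 0 ≤ s) (hsq : s ≤ 1 - q)
    (α : ℝ) (v : ℝ → ℂ) (k : ℤ) :
    fourierCoeffOn (lt_add_one (-(q / 2))) (modulatedWindow q α v s) k =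
      Complex.exp (-(2 * Real.pi * Complex.I * ((k - α) * s))) *
        windowTransform q v (k - α) := by
  rw [fourierCoeffOn_eq_integral, windowTransform, ← intervalIntegral.integral_const_mul]
  have h1 : ∀ x : ℝ, fourier (-k) (x : AddCircle (-(q / 2) + 1 - -(q / 2))) •
      modulatedWindow q α v s x = (Set.Ioc (s - q / 2) (s + q / 2)).indicator (fun x : ℝ =>
        Complex.exp (-(2 * Real.pi * Complex.I * ((k - α) * x))) * v (x - s)) x := by
    intro x
    by_cases hx : x ∈ Set.Ioc (s - q / 2) (s + q / 2)
    · rw [modulatedWindow, Set.indicator_of_mem hx, Set.indicator_of_mem hx, fourier_coe_apply,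
        add_sub_cancel_left, smul_eq_mul, ← mul_assoc, ← Complex.exp_add]
      congr 2
      push_cast
      ring
    · rw [modulatedWindow, Set.indicator_of_notMem hx, Set.indicator_of_notMem hx, smul_zero]
  simp_rw [h1]
  rw [intervalIntegral_indicator_Ioc (by linarith) (by linarith) (by linarith)]
  have h2 := intervalIntegral.integral_comp_add_right (a := -(q / 2)) (b := q / 2) (fun x : ℝ =>
    Complex.exp (-(2 * Real.pi * Complex.I * ((k - α) * x))) * v (x - s)) s
  rw [show s - q / 2 = -(q / 2) + s by ring, show s + q / 2 = q / 2 + s by ring, ← h2,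
    add_sub_cancel_left, div_one, one_smul]
  congr 1
  ext x
  rw [add_sub_cancel_right, ← mul_assoc (Complex.exp _), ← Complex.exp_add]
  congr 2
  push_cast
  ring

theorem hasSum_windowTransform_self {q : ℝ} (hq : 0 < q) (hq1 : q ≤ 1) (α : ℝ) {v : ℝ → ℂ}
    (hv : Continuous v) :
    HasSum (fun k : ℤ => ‖windowTransform q v (k - α)‖ ^ 2)
      (∫ x in (-(q / 2))..(q / 2), ‖v x‖ ^ 2) := by
  have h := hasSum_sq_fourierCoeffOn (lt_add_one (-(q / 2))) (memLp_modulatedWindow q α hv 0 _)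
  have h1 : ∀ k : ℤ, ‖fourierCoeffOn (lt_add_one (-(q / 2))) (modulatedWindow q α v 0) k‖ =
      ‖windowTransform q v (k - α)‖ := by
    intro k
    rw [fourierCoeffOn_modulatedWindow hq le_rfl (by linarith)]
    simp
  have h2 : ∀ x, ‖modulatedWindow q α v 0 x‖ ^ 2 =
      (Set.Ioc (-(q / 2)) (q / 2)).indicator (fun x => ‖v x‖ ^ 2) x := by
    intro x
    by_cases hx : x ∈ Set.Ioc (-(q / 2)) (q / 2)
    · rw [modulatedWindow, zero_sub, zero_add, Set.indicator_of_mem hx, Set.indicator_of_mem hx,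
        norm_mul, sub_zero, show (2 * Real.pi * Complex.I * (α * x) : ℂ) =
          ((2 * Real.pi * (α * x) : ℝ) : ℂ) * Complex.I by push_cast; ring,
        Complex.norm_exp_ofReal_mul_I, one_mul]
    · rw [modulatedWindow, zero_sub, zero_add, Set.indicator_of_notMem hx,
        Set.indicator_of_notMem hx]
      simp
  simp_rw [h1, h2] at h
  rwa [intervalIntegral_indicator_Ioc le_rfl (by linarith) (by linarith), add_sub_cancel_left,
    inv_one, one_smul] at h

theorem hasSum_windowTransform_of_separated {q : ℝ} (hq : 0 < q) (α : ℝ) {v : ℝ → ℂ}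
    (hv : Continuous v) {s : ℝ} (hs : ∀ r : ℤ, q ≤ |s + r|) :
    HasSum (fun k : ℤ => ((‖windowTransform q v (k - α)‖ ^ 2 : ℝ) : ℂ) *
      Complex.exp (2 * Real.pi * Complex.I * ((k - α) * s))) 0 := by
  have hl : q ≤ Int.fract s := by
    have := hs (-⌊s⌋)
    rwa [Int.cast_neg, ← sub_eq_add_neg, Int.self_sub_floor, Int.abs_fract] at this
  have hr : Int.fract s ≤ 1 - q := by
    have := hs (-⌊s⌋ - 1)
    rw [show s + ((-⌊s⌋ - 1 : ℤ) : ℝ) = -(1 - Int.fract s) by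
      rw [Int.fract]; push_cast; ring, abs_neg,
      abs_of_nonneg (by linarith [Int.fract_lt_one s])] at this
    linarith
  have h := hasSum_conj_fourierCoeffOn_mul (lt_add_one (-(q / 2)))
    (memLp_modulatedWindow q α hv (Int.fract s) _) (memLp_modulatedWindow q α hv 0 _)
  have h0 : ∀ x, conj (modulatedWindow q α v (Int.fract s) x) * modulatedWindow q α v 0 x = 0 := by
    intro x
    by_cases hx : x ∈ Set.Ioc (0 - q / 2) (0 + q / 2)
    · have hx' : x ∉ Set.Ioc (Int.fract s - q / 2) (Int.fract s + q / 2) := fun hx' => by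
        linarith [hx.2, hx'.1]
      rw [modulatedWindow, Set.indicator_of_notMem hx', map_zero, zero_mul]
    · rw [mul_comm, modulatedWindow, Set.indicator_of_notMem hx, zero_mul]
  simp_rw [h0] at h
  rw [intervalIntegral.integral_zero, smul_zero] at h
  have h' := h.mul_left (Complex.exp (-(2 * Real.pi * Complex.I * (α * ⌊s⌋))))
  rw [mul_zero] at h'
  refine (congrArg (HasSum · (0 : ℂ)) (funext fun k => ?_)).mp h'
  rw [fourierCoeffOn_modulatedWindow hq (hq.le.trans hl) hr,
    fourierCoeffOn_modulatedWindow hq le_rfl (by linarith), Complex.ofReal_zero, mul_zero, mul_zero,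
    neg_zero, Complex.exp_zero, one_mul, map_mul, mul_assoc _ (conj (windowTransform _ _ _)),
    Complex.conj_mul', ← Complex.exp_conj, ← mul_assoc, ← Complex.exp_add, Complex.ofReal_pow,
    mul_comm]
  congr 1
  rw [Complex.exp_eq_exp_iff_exists_int]
  refine ⟨-(k * ⌊s⌋), ?_⟩
  simp only [Int.fract, map_neg, map_mul, map_sub, Complex.conj_ofReal, Complex.conj_I,
    map_ofNat, map_intCast]
  push_cast
  ring

theorem windowTransform_sin {q : ℝ} (hq : 0 < q) (β : ℝ) :
    windowTransform q (fun x => (Real.sin (Real.pi / q * x) : ℂ)) β =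
      -(2 * Complex.I * q * β) *
        windowTransform q (fun x => (Real.cos (Real.pi / q * x) : ℂ)) β := by
  have hexp : ∀ x : ℝ, HasDerivAt
      (fun x : ℝ => Complex.exp (-(2 * Real.pi * Complex.I * (β * x))))
      (Complex.exp (-(2 * Real.pi * Complex.I * (β * x))) * -(2 * Real.pi * Complex.I * β)) x := by
    intro x
    have h := (((hasDerivAt_id x).ofReal_comp.const_mul (β : ℂ)).const_mul
      (2 * Real.pi * Complex.I)).neg.cexp
    simpa using h
  have hcos : ∀ x : ℝ, HasDerivAt (fun x : ℝ => (Real.cos (Real.pi / q * x) : ℂ))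
      (-(Real.pi / q) * Real.sin (Real.pi / q * x)) x := by
    intro x
    have h := ((hasDerivAt_id' x).const_mul (Real.pi / q)).cos.ofReal_comp
    convert h using 1
    push_cast
    ring
  have hftc := intervalIntegral.integral_eq_sub_of_hasDerivAt (a := -(q / 2)) (b := q / 2)
    (fun x _ => (hexp x).mul (hcos x)) (Continuous.intervalIntegrable (by fun_prop) _ _)
  have hend : Real.cos (Real.pi / q * (q / 2)) = 0 := by
    rw [show Real.pi / q * (q / 2) = Real.pi / 2 by field_simp, Real.cos_pi_div_two]
  have hend' : Real.cos (Real.pi / q * -(q / 2)) = 0 := by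
    rw [mul_neg, Real.cos_neg, hend]
  simp only [Pi.mul_apply, hend, hend', Complex.ofReal_zero, mul_zero, sub_zero] at hftc
  have hsplit : ∀ x : ℝ, Complex.exp (-(2 * Real.pi * Complex.I * (β * x))) *
        -(2 * Real.pi * Complex.I * β) * (Real.cos (Real.pi / q * x) : ℂ) +
      Complex.exp (-(2 * Real.pi * Complex.I * (β * x))) *
        (-(Real.pi / q) * Real.sin (Real.pi / q * x)) =
      -(2 * Real.pi * Complex.I * β) * (Complex.exp (-(2 * Real.pi * Complex.I * (β * x))) *
        (Real.cos (Real.pi / q * x) : ℂ)) +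
      -(Real.pi / q) * (Complex.exp (-(2 * Real.pi * Complex.I * (β * x))) *
        (Real.sin (Real.pi / q * x) : ℂ)) := fun x => by ring
  simp_rw [hsplit] at hftc
  rw [intervalIntegral.integral_add (Continuous.intervalIntegrable (by fun_prop) _ _)
    (Continuous.intervalIntegrable (by fun_prop) _ _), intervalIntegral.integral_const_mul,
    intervalIntegral.integral_const_mul] at hftc
  have hpi : (Real.pi : ℂ) ≠ 0 := Complex.ofReal_ne_zero.2 Real.pi_ne_zero
  have hq' : (q : ℂ) ≠ 0 := Complex.ofReal_ne_zero.2 hq.ne'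
  change _ * windowTransform q (fun x => (Real.cos (Real.pi / q * x) : ℂ)) β +
    _ * windowTransform q (fun x => (Real.sin (Real.pi / q * x) : ℂ)) β = 0 at hftc
  refine mul_left_cancel₀ (div_ne_zero hpi hq') ?_
  linear_combination -hftc + 2 * Real.pi * Complex.I * β *
    windowTransform q (fun x => (Real.cos (Real.pi / q * x) : ℂ)) β * mul_inv_cancel₀ hq'

theorem integral_cos_window_sq {q : ℝ} (hq : 0 < q) :
    ∫ x in (-(q / 2))..(q / 2), ‖(Real.cos (Real.pi / q * x) : ℂ)‖ ^ 2 = q / 2 := by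
  have hc : Real.pi / q ≠ 0 := (div_pos Real.pi_pos hq).ne'
  simp_rw [Complex.norm_real, Real.norm_eq_abs, sq_abs]
  rw [intervalIntegral.integral_comp_mul_left (fun x => Real.cos x ^ 2) hc, integral_cos_sq,
    show Real.pi / q * (q / 2) = Real.pi / 2 by field_simp,
    show Real.pi / q * -(q / 2) = -(Real.pi / 2) by field_simp]
  simp
  field_simp

theorem integral_sin_window_sq {q : ℝ} (hq : 0 < q) :
    ∫ x in (-(q / 2))..(q / 2), ‖(Real.sin (Real.pi / q * x) : ℂ)‖ ^ 2 = q / 2 := by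
  have hc : Real.pi / q ≠ 0 := (div_pos Real.pi_pos hq).ne'
  simp_rw [Complex.norm_real, Real.norm_eq_abs, sq_abs]
  rw [intervalIntegral.integral_comp_mul_left (fun x => Real.sin x ^ 2) hc, integral_sin_sq,
    show Real.pi / q * (q / 2) = Real.pi / 2 by field_simp,
    show Real.pi / q * -(q / 2) = -(Real.pi / 2) by field_simp]
  simp
  field_simp

/-- A nonnegative weight on the shifted lattice `ℤ - α` whose Fourier series, as well as that of its
second moment, vanishes at distance at least `q` from the integers. -/
theorem exists_univariate_weight {q : ℝ} (hq : 0 < q) (hq1 : q ≤ 1) (α : ℝ) :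
    ∃ w : ℤ → ℝ, (∀ k, 0 ≤ w k) ∧ HasSum w (q / 2) ∧
      HasSum (fun k => (k - α) ^ 2 * w k) (q / 2 * (1 / (4 * q ^ 2))) ∧
      ∀ s : ℝ, (∀ r : ℤ, q ≤ |s + r|) →
        HasSum (fun k : ℤ => (w k : ℂ) *
          Complex.exp (2 * Real.pi * Complex.I * ((k - α) * s))) 0 ∧
        HasSum (fun k : ℤ => (((k - α) ^ 2 * w k : ℝ) : ℂ) *
          Complex.exp (2 * Real.pi * Complex.I * ((k - α) * s))) 0 := by
  have hcos : Continuous fun x : ℝ => (Real.cos (Real.pi / q * x) : ℂ) := by fun_prop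
  have hsin : Continuous fun x : ℝ => (Real.sin (Real.pi / q * x) : ℂ) := by fun_prop
  obtain ⟨c, hc⟩ : ∃ c : ℝ, c = 1 / (4 * q ^ 2) := ⟨_, rfl⟩
  rw [← hc]
  have hmom : ∀ k : ℤ, (k - α) ^ 2 *
      ‖windowTransform q (fun x => (Real.cos (Real.pi / q * x) : ℂ)) (k - α)‖ ^ 2 =
      c * ‖windowTransform q (fun x => (Real.sin (Real.pi / q * x) : ℂ)) (k - α)‖ ^ 2 := by
    intro k
    rw [windowTransform_sin hq, norm_mul, mul_pow, show ‖-(2 * Complex.I * q * ((k - α : ℝ) : ℂ))‖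
      = 2 * |q| * |k - α| by simp [-Complex.ofReal_sub], mul_pow, mul_pow, sq_abs, sq_abs, hc]
    field_simp
    ring
  refine ⟨fun k => ‖windowTransform q (fun x => (Real.cos (Real.pi / q * x) : ℂ)) (k - α)‖ ^ 2,
    fun k => sq_nonneg _, ?_, ?_, fun s hs => ⟨hasSum_windowTransform_of_separated hq α hcos hs, ?_⟩⟩
  · rw [← integral_cos_window_sq hq]
    exact hasSum_windowTransform_self hq hq1 α hcos
  · simp_rw [hmom]
    rw [mul_comm, ← integral_sin_window_sq hq]
    exact (hasSum_windowTransform_self hq hq1 α hsin).mul_left _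
  · have h := (hasSum_windowTransform_of_separated hq α hsin hs).mul_left (c : ℂ)
    rw [mul_zero] at h
    refine (congrArg (HasSum · (0 : ℂ)) (funext fun k => ?_)).mp h
    rw [hmom k, Complex.ofReal_mul c]
    ring

/-- A weight on the shifted lattice `ℤ ^ d - (n / 2, …, n / 2)` which is nonpositive off the cube
`{0, …, n} ^ d`, has positive sum, and whose Fourier series vanishes at points separated from
`ℤ ^ d` by `q` in the supremum norm. -/
theorem exists_multivariate_weight {q : ℝ} (hq : 0 < q) (hq1 : q ≤ 1) {d n : ℕ}
    (hn : √d / q < n) :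
    ∃ D : (Fin d → ℤ) → ℝ, ∃ C : ℝ, 0 < C ∧ HasSum D C ∧
      (∀ k, (∃ i, k i < 0 ∨ (n : ℤ) < k i) → D k ≤ 0) ∧
      ∀ s : Fin d → ℝ, (∃ i, ∀ r : ℤ, q ≤ |s i + r|) →
        HasSum (fun k => (D k : ℂ) *
          ∏ i, Complex.exp (2 * Real.pi * Complex.I * ((k i - (n / 2 : ℝ)) * s i))) 0 := by
  obtain ⟨w, hw0, hw, hw2, hsep⟩ := exists_univariate_weight hq hq1 (n / 2)
  set α : ℝ := n / 2 with hα
  have hcomb : ∀ {R : Type} [Field R] (b W : Fin d → R) (c : R),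
      (c - ∑ i, b i) * ∏ i, W i = c * ∏ i, W i - ∑ i, ∏ j, if j = i then b j * W j else W j := by
    intro R _ b W c
    rw [sub_mul, Finset.sum_mul]
    congr 1
    refine Finset.sum_congr rfl fun i _ => ?_
    rw [← Finset.mul_prod_erase _ (fun j => if j = i then b j * W j else W j) (Finset.mem_univ i),
      ← Finset.mul_prod_erase _ W (Finset.mem_univ i), if_pos rfl, mul_assoc]
    congr 2
    exact Finset.prod_congr rfl fun j hj => (if_neg (Finset.ne_of_mem_erase hj)).symm
  have hw2_0 : ∀ k : ℤ, 0 ≤ (k - α) ^ 2 * w k := fun k => mul_nonneg (sq_nonneg _) (hw0 k)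
  refine ⟨fun k => (n ^ 2 / 4 - ∑ i, (k i - α) ^ 2) * ∏ i, w (k i),
    (n ^ 2 / 4 - ∑ i : Fin d, 1 / (4 * q ^ 2)) * ∏ i : Fin d, (q / 2), ?_, ?_, ?_, ?_⟩
  · refine mul_pos ?_ (Finset.prod_pos fun i _ => by positivity)
    have h1 : √d < n * q := (div_lt_iff₀ hq).1 hn
    have h2 : (d : ℝ) < (n * q) ^ 2 := (Real.sqrt_lt_sqrt_iff_of_pos (by
      exact pow_pos ((Real.sqrt_nonneg _).trans_lt h1) 2)).1 <| by
        rwa [Real.sqrt_sq ((Real.sqrt_nonneg _).trans h1.le)]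
    rw [Finset.sum_const, Finset.card_univ, Fintype.card_fin, nsmul_eq_mul, sub_pos, mul_one_div,
      div_lt_div_iff₀ (by positivity) (by positivity)]
    nlinarith
  · simp_rw [hcomb]
    refine HasSum.sub (HasSum.mul_left _ (hasSum_prod_pi_of_summable_norm
      (fun _ => hw.summable.norm) fun _ => hw)) (hasSum_sum fun i _ => ?_)
    have := hasSum_prod_pi_of_summable_norm
      (f := fun j k => if j = i then (k - α) ^ 2 * w k else w k)
      (a := fun j => if j = i then 1 / (4 * q ^ 2) * (q / 2) else q / 2)
      (fun j => by split_ifs; exacts [hw2.summable.norm, hw.summable.norm])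
      (fun j => by split_ifs; exacts [by rwa [mul_comm], hw])
    exact this
  · rintro k ⟨i, hi⟩
    refine mul_nonpos_of_nonpos_of_nonneg ?_ (Finset.prod_nonneg fun i _ => hw0 _)
    have h1 : (n : ℝ) ^ 2 / 4 ≤ (k i - α) ^ 2 := by
      rw [hα]
      rcases hi with hi | hi
      · have : (k i : ℝ) < 0 := by exact_mod_cast hi
        nlinarith [(n.cast_nonneg : (0 : ℝ) ≤ n)]
      · have : (n : ℝ) < k i := by exact_mod_cast hi
        nlinarith [(n.cast_nonneg : (0 : ℝ) ≤ n)]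
    have h2 := Finset.single_le_sum (f := fun i => ((k i : ℝ) - α) ^ 2) (fun i _ => sq_nonneg _)
      (Finset.mem_univ i)
    linarith
  · rintro s ⟨i₀, hi₀⟩
    obtain ⟨hz, hz2⟩ := hsep (s i₀) hi₀
    have hnorm : ∀ (k : ℤ) (x : ℝ),
        ‖Complex.exp (2 * Real.pi * Complex.I * ((k - α) * x))‖ = 1 := by
      intro k x
      rw [show (2 * Real.pi * Complex.I * ((k - α) * x) : ℂ) =
        ((2 * Real.pi * ((k - α) * x) : ℝ) : ℂ) * Complex.I by push_cast; ring,
        Complex.norm_exp_ofReal_mul_I]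
    have hs1 : ∀ x : ℝ, Summable fun k : ℤ =>
        ‖(w k : ℂ) * Complex.exp (2 * Real.pi * Complex.I * ((k - α) * x))‖ := fun x => by
      simpa only [norm_mul, hnorm, mul_one, Complex.norm_real] using hw.summable.norm
    have hs2 : ∀ x : ℝ, Summable fun k : ℤ => ‖(((k - α) ^ 2 * w k : ℝ) : ℂ) *
        Complex.exp (2 * Real.pi * Complex.I * ((k - α) * x))‖ := fun x => by
      simpa only [norm_mul, hnorm, mul_one, Complex.norm_real] using hw2.summable.norm
    have hsum : ∀ p : Fin d → Prop, ∀ [DecidablePred p], HasSum (fun k : Fin d → ℤ => ∏ j,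
        if p j then (((k j - α) ^ 2 * w (k j) : ℝ) : ℂ) *
          Complex.exp (2 * Real.pi * Complex.I * ((k j - α) * s j))
        else (w (k j) : ℂ) * Complex.exp (2 * Real.pi * Complex.I * ((k j - α) * s j))) 0 := by
      intro p _
      have h := hasSum_prod_pi_of_summable_norm
        (f := fun j (k : ℤ) => if p j then (((k - α) ^ 2 * w k : ℝ) : ℂ) *
          Complex.exp (2 * Real.pi * Complex.I * ((k - α) * s j))
        else (w k : ℂ) * Complex.exp (2 * Real.pi * Complex.I * ((k - α) * s j)))
        (fun j => by split_ifs; exacts [hs2 _, hs1 _])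
        (fun j => (Summable.of_norm (by split_ifs; exacts [hs2 _, hs1 _])).hasSum)
      rwa [Finset.prod_eq_zero (Finset.mem_univ i₀)
        (by split_ifs; exacts [hz2.tsum_eq, hz.tsum_eq])] at h
    have h0 := (hsum fun _ => False).mul_left ((n : ℂ) ^ 2 / 4)
    have h := h0.sub (hasSum_sum (s := Finset.univ) fun i _ => hsum fun j => j = i)
    rw [mul_zero, Finset.sum_const_zero, sub_zero] at h
    refine (congrArg (HasSum · (0 : ℂ)) (funext fun k => ?_)).mp h
    have hk := hcomb (fun i => (((k i : ℝ) - α : ℝ) : ℂ) ^ 2) (fun i => (w (k i) : ℂ) *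
      Complex.exp (2 * Real.pi * Complex.I * ((k i - α) * s i))) ((n : ℂ) ^ 2 / 4)
    rw [Finset.prod_mul_distrib, ← mul_assoc] at hk
    push_cast at hk ⊢
    rw [hk]
    simp [mul_assoc, Finset.prod_mul_distrib]

theorem exists_coordinate_separation {d : ℕ} {q : ℝ} (hq : 0 < q) {x : Fin d → ℝ}
    (hx : ∀ r : Fin d → ℤ, q < ‖(fun i => x i + (r i : ℝ) : Fin d → ℝ)‖) :
    ∃ i, ∀ r : ℤ, q ≤ |x i + r| := by
  obtain ⟨i, hi⟩ : ∃ i, q < |x i - round (x i)| := by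
    by_contra! hc
    refine (hx fun i => -round (x i)).not_ge ((pi_norm_le_iff_of_nonneg hq.le).2 fun i => ?_)
    simpa [← sub_eq_add_neg] using hc i
  refine ⟨i, fun r => ?_⟩
  have h := round_le (x i) (-r)
  rw [Int.cast_neg, sub_neg_eq_add] at h
  exact hi.le.trans h

theorem le_one_of_forall_int_le_abs_add {q x : ℝ} (h : ∀ r : ℤ, q ≤ |x + r|) : q ≤ 1 := by
  have h1 := h (-⌊x⌋)
  rw [Int.cast_neg, ← sub_eq_add_neg, Int.self_sub_floor, Int.abs_fract] at h1
  exact h1.trans (Int.fract_lt_one x).le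

/-- If a trigonometric sum with `q`-separated frequencies vanishes on `{0, …, n} ^ d`, where
`√d / q < n`, then its coefficients are zero. -/
theorem eq_zero_of_trigonometric_sum_eq_zero {d n : ℕ} {ι : Type*} [Fintype ι]
    {t : ι → Fin d → ℝ} {q : ℝ} (hq : 0 < q) (hq1 : q ≤ 1) (hn : √d / q < n)
    (hsep : ∀ j l, j ≠ l → ∃ i, ∀ r : ℤ, q ≤ |t j i - t l i + r|) {a : ι → ℂ}
    (ha : ∀ k : Fin d → ℤ, (∀ i, 0 ≤ k i ∧ k i ≤ n) →
      ∑ j, a j * ∏ i, Complex.exp (2 * Real.pi * Complex.I * ((k i - (n / 2 : ℝ)) * t j i)) = 0) :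
    a = 0 := by
  classical
  obtain ⟨D, C, hC, hD, hDle, hDsep⟩ := exists_multivariate_weight hq hq1 hn
  set E : (Fin d → ℤ) → (Fin d → ℝ) → ℂ := fun k x =>
    ∏ i, Complex.exp (2 * Real.pi * Complex.I * ((k i - (n / 2 : ℝ)) * x i)) with hE
  have hEsub : ∀ k x y, E k x * conj (E k y) = E k (x - y) := by
    intro k x y
    simp only [hE, map_prod]
    rw [← Finset.prod_mul_distrib]
    refine Finset.prod_congr rfl fun i _ => ?_
    rw [← Complex.exp_conj, ← Complex.exp_add]
    congr 1
    simp only [map_mul, map_sub, Complex.conj_ofReal, Complex.conj_I, map_ofNat, map_intCast,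
      Pi.sub_apply, Complex.ofReal_sub]
    ring
  have hterm : ∀ j l, HasSum (fun k => (D k : ℂ) * E k (t j - t l))
      (if j = l then (C : ℂ) else 0) := by
    intro j l
    split_ifs with h
    · have h1 : ∀ k, E k (t j - t l) = 1 := fun k => by simp [hE, h]
      simp_rw [h1, mul_one]
      exact Complex.hasSum_ofReal.2 hD
    · exact hDsep _ (hsep j l h)
  have hsum : HasSum (fun k => ∑ j, ∑ l, a j * conj (a l) * ((D k : ℂ) * E k (t j - t l)))
      (∑ j, ∑ l, a j * conj (a l) * if j = l then (C : ℂ) else 0) :=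
    hasSum_sum fun j _ => hasSum_sum fun l _ => (hterm j l).mul_left _
  have hval : ∑ j, ∑ l, a j * conj (a l) * (if j = l then (C : ℂ) else 0) =
      ((C * ∑ j, ‖a j‖ ^ 2 : ℝ) : ℂ) := by
    simp [Complex.mul_conj', Finset.mul_sum, mul_comm]
  have hsq : ∀ k, ∑ j, ∑ l, a j * conj (a l) * ((D k : ℂ) * E k (t j - t l)) =
      ((D k * ‖∑ j, a j * E k (t j)‖ ^ 2 : ℝ) : ℂ) := by
    intro k
    rw [Complex.ofReal_mul, Complex.ofReal_pow, ← Complex.mul_conj', map_sum,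
      Finset.sum_mul_sum, Finset.mul_sum]
    refine Finset.sum_congr rfl fun j _ => ?_
    rw [Finset.mul_sum]
    refine Finset.sum_congr rfl fun l _ => ?_
    rw [← hEsub, map_mul]
    ring
  simp_rw [hval, hsq] at hsum
  have hnonpos : C * ∑ j, ‖a j‖ ^ 2 ≤ 0 := by
    refine hasSum_le (fun k => ?_) (Complex.hasSum_ofReal.1 hsum) hasSum_zero
    by_cases hk : ∀ i, 0 ≤ k i ∧ k i ≤ n
    · rw [ha k hk]
      simp
    · push Not at hk
      obtain ⟨i, hi⟩ := hk
      refine mul_nonpos_of_nonpos_of_nonneg (hDle k ⟨i, ?_⟩) (sq_nonneg _)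
      by_contra! h
      exact (hi h.1).not_ge h.2
  have hzero : ∑ j, ‖a j‖ ^ 2 = 0 :=
    le_antisymm (nonpos_of_mul_nonpos_right hnonpos hC) (Finset.sum_nonneg fun j _ => sq_nonneg _)
  ext j
  have h := (Finset.sum_eq_zero_iff_of_nonneg fun j _ => sq_nonneg ‖a j‖).1 hzero j
    (Finset.mem_univ j)
  simpa using h

/-- **Lemma 3.10 (Ingham-type condition).** Let `t_1,…,t_M ∈ [0,1)^d` be `q`-separated,
i.e. `‖t_j − t_ℓ + r‖_∞ > q` for all `j ≠ ℓ` and all `r ∈ ℤ^d`. If `n > √d / q`, then the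
Fourier–Vandermonde matrix `F_n ∈ ℂ^{M×(n+1)^d}` has full rank `M`. -/
theorem fourier_matrix_full_rank_of_separation
    {d M : ℕ} (hd : 0 < d) (t : Fin M → Fin d → ℝ)
    (ht01 : ∀ j i, t j i ∈ Set.Ico (0 : ℝ) 1)
    (q : ℝ) (hq : 0 < q)
    (hsep : ∀ j ℓ, j ≠ ℓ → ∀ r : Fin d → ℤ,
      q < ‖(fun i => t j i - t ℓ i + (r i : ℝ) : Fin d → ℝ)‖)
    (n : ℕ) (hn : Real.sqrt d / q < n) :
    (fourierMatrix d t n).rank = M := by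
  have hrow : LinearIndependent ℂ (fourierMatrix d t n).row := by
    rw [Fintype.linearIndependent_iff]
    intro c hc
    have hc' : ∀ k : Fin d → Fin (n + 1), ∑ j, c j *
        Complex.exp (2 * Real.pi * Complex.I * ∑ i, ((k i : ℕ) : ℂ) * (t j i : ℂ)) = 0 := by
      intro k
      have h := congrFun hc k
      rw [Finset.sum_apply] at h
      exact h
    by_cases hM : ∃ j l : Fin M, j ≠ l
    · have hsep' : ∀ j l, j ≠ l → ∃ i, ∀ r : ℤ, q ≤ |t j i - t l i + r| := fun j l h =>
        exists_coordinate_separation hq (hsep j l h)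
      have hq1 : q ≤ 1 := by
        obtain ⟨j, l, h⟩ := hM
        obtain ⟨i, hi⟩ := hsep' j l h
        exact le_one_of_forall_int_le_abs_add hi
      have ha := eq_zero_of_trigonometric_sum_eq_zero hq hq1 hn hsep' (a := fun j =>
        c j * Complex.exp (2 * Real.pi * Complex.I * ∑ i, (n / 2 : ℝ) * (t j i : ℂ))) <| by
          intro k hk
          rw [← hc' fun i => ⟨(k i).toNat, by have := hk i; omega⟩]
          refine Finset.sum_congr rfl fun j _ => ?_
          rw [mul_assoc, ← Complex.exp_sum, ← Complex.exp_add, Finset.mul_sum, Finset.mul_sum,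
            ← Finset.sum_add_distrib]
          congr 2
          refine Finset.sum_congr rfl fun i _ => ?_
          have hki : (((k i).toNat : ℕ) : ℂ) = k i := by
            exact_mod_cast congrArg (Int.cast : ℤ → ℂ) (Int.toNat_of_nonneg (hk i).1)
          simp only [hki]
          ring
      intro j
      simpa using congrFun ha j
    · push Not at hM
      intro j
      have h := hc' fun _ => 0
      rw [Finset.sum_eq_single j (fun l _ hl => absurd (hM l j) hl) (by simp)] at h
      simpa using h
  simpa using hrow.rank_matrix
end

section
/- Let x_1,…,x_M ∈ S^{d−1} be pairwise distinct with separation distance sep := min_{j≠ℓ} arccos(x_jᵀ x_ℓ) > q for some q > 0. If n ∈ ℕ₀ satisfies n > 2.5π d / q, then the evaluation map sending each real polynomial of total degree at most n to the vector (p(x_1),…,p(x_M)) ∈ ℝ^M is surjective; equivalently, the nonequispaced spherical Fourier matrix Y_n = (Y_k^ℓ(x_j))_{j=1,…,M; k≤n, ℓ=1,…,N_k} has full rank M. -/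
open Polynomial in
/-- A polynomial of degree at most `m - 1` whose values on `[-1, 1]` are those of the Fejér kernel:
`Q (cos θ) = (1 - cos (m θ)) / (1 - cos θ)`. -/
theorem exists_fejer_polynomial (m : ℕ) :
    ∃ Q : ℝ[X], Q.natDegree ≤ m - 1 ∧ Q.eval 1 = (m : ℝ) ^ 2 ∧
      ∀ t : ℝ, |t| ≤ 1 → |Q.eval t| * (1 - t) ≤ 2 := by
  set T := Chebyshev.T ℝ (m : ℤ) with hT
  have hdecomp : C 1 + (X - C 1) * (T /ₘ (X - C 1)) = T := by
    have h := modByMonic_add_div T (X - C (1 : ℝ))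
    rwa [modByMonic_X_sub_C_eq_C_eval, hT, Chebyshev.T_eval_one] at h
  refine ⟨T /ₘ (X - C 1), ?_, ?_, fun t ht => ?_⟩
  · rw [natDegree_divByMonic _ (monic_X_sub_C 1), natDegree_X_sub_C, hT, Chebyshev.natDegree_T]
    simp
  · have h := Chebyshev.derivative_T_eval_one (R := ℝ) (m : ℤ)
    rw [← hT, ← hdecomp] at h
    simpa [derivative_mul] using h
  · have h := congrArg (eval t) hdecomp
    simp only [eval_add, eval_mul, eval_sub, eval_X, eval_C] at h
    have hb := abs_le.mp (Chebyshev.abs_eval_T_real_le_one (m : ℤ) ht)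
    have ht' := (abs_le.mp ht).2
    rw [← hT] at hb
    rw [← abs_of_nonneg (sub_nonneg.mpr ht'), ← abs_mul, abs_le]
    constructor <;> linarith

open MeasureTheory Metric Module in
/-- The volume bound for the number of `δ`-separated points in a ball of radius `R`. -/
theorem card_mul_pow_le_of_separated {E : Type*} [NormedAddCommGroup E] [NormedSpace ℝ E]
    [FiniteDimensional ℝ E] {ι : Type*} (s : Finset ι) (x : ι → E) (a : E) {δ R : ℝ} (hδ : 0 < δ)
    (hR : 0 ≤ R) (hs : ∀ i ∈ s, dist (x i) a ≤ R)
    (hsep : ∀ i ∈ s, ∀ j ∈ s, i ≠ j → δ ≤ dist (x i) (x j)) :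
    (s.card : ℝ) * (δ / 2) ^ finrank ℝ E ≤ (R + δ / 2) ^ finrank ℝ E := by
  borelize E
  let μ : Measure E := Measure.addHaar
  have hδ2 : 0 < δ / 2 := by positivity
  have hR2 : 0 < R + δ / 2 := by positivity
  have hdisj : Set.Pairwise (s : Set ι) (Function.onFun Disjoint fun i => ball (x i) (δ / 2)) := by
    intro i hi j hj hij
    exact ball_disjoint_ball (by simpa using hsep i hi j hj hij)
  have hsub : (⋃ i ∈ s, ball (x i) (δ / 2)) ⊆ ball a (R + δ / 2) :=
    Set.iUnion₂_subset fun i hi => ball_subset_ball' (by linarith [hs i hi])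
  have hvol : (s.card : ENNReal) * ENNReal.ofReal ((δ / 2) ^ finrank ℝ E) * μ (ball 0 1) ≤
      ENNReal.ofReal ((R + δ / 2) ^ finrank ℝ E) * μ (ball 0 1) := by
    calc
      _ = μ (⋃ i ∈ s, ball (x i) (δ / 2)) := by
        rw [measure_biUnion_finset hdisj fun i _ => measurableSet_ball]
        simp only [μ.addHaar_ball_of_pos _ hδ2, Finset.sum_const, nsmul_eq_mul, mul_assoc]
      _ ≤ μ (ball a (R + δ / 2)) := measure_mono hsub
      _ = _ := μ.addHaar_ball_of_pos _ hR2
  have hcard := (ENNReal.mul_le_mul_iff_left (measure_ball_pos _ _ zero_lt_one).ne'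
    measure_ball_lt_top.ne).1 hvol
  simpa [ENNReal.toReal_mul, ENNReal.toReal_ofReal (pow_nonneg hδ2.le _)] using
    ENNReal.toReal_le_of_le_ofReal (pow_nonneg hR2.le _) hcard

/-- If at most `A * b i` of the numbers `b j ≥ 1` are bounded by `b i`, then the sum of their
inverse squares is at most `2 * A`. -/
theorem sum_inv_sq_le_of_card_le {ι : Type*} {A : ℕ} (hA : 0 < A) (s : Finset ι) (b : ι → ℝ)
    (hb : ∀ i ∈ s, 1 ≤ b i)
    (hcard : ∀ i ∈ s, ∀ t ⊆ s, (∀ j ∈ t, b j ≤ b i) → (t.card : ℝ) ≤ A * b i) :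
    ∑ i ∈ s, ((b i) ^ 2)⁻¹ ≤ 2 * A := by
  classical
  have hA' : (0 : ℝ) < A := by exact_mod_cast hA
  suffices h : ∑ i ∈ s, ((b i) ^ 2)⁻¹ ≤ s.card ∧
      (A ≤ s.card → ∑ i ∈ s, ((b i) ^ 2)⁻¹ ≤ 2 * A - (A : ℝ) ^ 2 / s.card) by
    rcases le_total A s.card with hle | hle
    · have : (0 : ℝ) ≤ (A : ℝ) ^ 2 / s.card := by positivity
      linarith [h.2 hle]
    · have : (s.card : ℝ) ≤ A := by exact_mod_cast hle
      linarith [h.1]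
  induction s using Finset.induction_on_max_value b with
  | empty => simp [hA.ne']
  | insert a s ha hmax ih =>
    have hb1 := hb a (Finset.mem_insert_self a s)
    obtain ⟨ih1, ih2⟩ := ih (fun i hi => hb i (Finset.mem_insert_of_mem hi))
      fun i hi t ht => hcard i (Finset.mem_insert_of_mem hi) t
        (ht.trans (Finset.subset_insert a s))
    have hk := hcard a (Finset.mem_insert_self a s) _ subset_rfl (by simpa using hmax)
    rw [Finset.card_insert_of_notMem ha] at hk ⊢
    rw [Finset.sum_insert ha]
    have hone : ((b a) ^ 2)⁻¹ ≤ 1 := inv_le_one_of_one_le₀ (one_le_pow₀ hb1)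
    refine ⟨by push_cast; linarith, fun hle => ?_⟩
    push_cast at hk ⊢
    rcases hle.eq_or_lt with heq | hlt
    · have heq' : (A : ℝ) = s.card + 1 := by exact_mod_cast heq
      rw [← heq']
      have : (A : ℝ) ^ 2 / A = A := by field_simp
      linarith
    · have hle' : A ≤ s.card := by omega
      have hs : (0 : ℝ) < s.card := by exact_mod_cast hA.trans_le hle'
      have hsq : ((b a) ^ 2)⁻¹ ≤ (A : ℝ) ^ 2 / (s.card + 1) ^ 2 := by
        rw [inv_le_comm₀ (by positivity) (by positivity), inv_div, ← div_pow]
        gcongr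
        rwa [div_le_iff₀ hA', mul_comm]
      have htel : (A : ℝ) ^ 2 / (s.card + 1) ^ 2 ≤
          (A : ℝ) ^ 2 / s.card - (A : ℝ) ^ 2 / (s.card + 1) := by
        rw [div_sub_div _ _ hs.ne' (by positivity), div_le_div_iff₀ (by positivity) (by positivity)]
        have : 0 ≤ (A : ℝ) ^ 2 * (s.card + 1) := by positivity
        nlinarith
      linarith [ih2 hle']

open MvPolynomial in
/-- The polynomial `y ↦ F (⟨a, y⟩)` has total degree at most the degree of `F`. -/
theorem totalDegree_aeval_linear_le {d : ℕ} (a : Fin d → ℝ) (F : Polynomial ℝ) :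
    (Polynomial.aeval (∑ i, C (a i) * X i : MvPolynomial (Fin d) ℝ) F).totalDegree
      ≤ F.natDegree := by
  rw [Polynomial.aeval_eq_sum_range]
  refine totalDegree_finsetSum_le fun k hk => ?_
  refine (totalDegree_smul_le _ _).trans ((totalDegree_pow _ _).trans ?_)
  have hlin : (∑ i, C (a i) * X i : MvPolynomial (Fin d) ℝ).totalDegree ≤ 1 :=
    totalDegree_finsetSum_le fun i _ => (totalDegree_mul _ _).trans (by simp)
  have := Finset.mem_range_succ_iff.mp hk
  nlinarith

/-- Interpolation by zonal polynomials whose kernel matrix is strictly diagonally dominant. -/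
theorem exists_interpolant_of_diag_dominant {d M n : ℕ} (x : Fin M → Fin d → ℝ) (F : Polynomial ℝ)
    (hF : F.natDegree ≤ n)
    (hdom : ∀ j, ∑ l ∈ Finset.univ.erase j, |F.eval (∑ i, x j i * x l i)| <
      |F.eval (∑ i, x j i * x j i)|) (v : Fin M → ℝ) :
    ∃ p : MvPolynomial (Fin d) ℝ,
      p.totalDegree ≤ n ∧ ∀ j, MvPolynomial.eval (x j) p = v j := by
  let K : Matrix (Fin M) (Fin M) ℝ := fun j l => F.eval (∑ i, x j i * x l i)
  have hdet : K.det ≠ 0 := det_ne_zero_of_sum_row_lt_diag hdom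
  refine ⟨∑ l, MvPolynomial.C ((K⁻¹.mulVec v) l) *
    Polynomial.aeval (∑ i, MvPolynomial.C (x l i) * MvPolynomial.X i) F, ?_, fun j => ?_⟩
  · refine MvPolynomial.totalDegree_finsetSum_le fun l _ =>
      (MvPolynomial.totalDegree_mul _ _).trans ?_
    rw [MvPolynomial.totalDegree_C, zero_add]
    exact (totalDegree_aeval_linear_le _ _).trans hF
  · have heval : ∀ l, MvPolynomial.eval (x j) (Polynomial.aeval
        (∑ i, MvPolynomial.C (x l i) * MvPolynomial.X i : MvPolynomial (Fin d) ℝ) F) = K j l := by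
      intro l
      rw [← MvPolynomial.coe_aeval_eq_eval, RingHom.coe_coe, ← Polynomial.aeval_algHom_apply]
      simp [K, mul_comm, Polynomial.aeval_def, Polynomial.eval₂_eq_eval_map]
    have hsolve : K.mulVec (K⁻¹.mulVec v) = v := by
      rw [Matrix.mulVec_mulVec, Matrix.mul_nonsing_inv _ (isUnit_iff_ne_zero.mpr hdet),
        Matrix.one_mulVec]
    simp only [map_sum, map_mul, MvPolynomial.eval_C, heval]
    simpa [Matrix.mulVec, dotProduct, mul_comm] using congrFun hsolve j

/-- Around each of a family of `δ`-separated points of a `d`-dimensional space, the sum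
of `(δ / distance)^(2d)` over the other points is at most `2 * 3^d`. -/
theorem sum_div_dist_pow_le_of_separated {E : Type*} [NormedAddCommGroup E] [NormedSpace ℝ E]
    [FiniteDimensional ℝ E] {ι : Type*} (s : Finset ι) (x : ι → E) (a : E) {δ : ℝ} (hδ : 0 < δ)
    (ha : ∀ i ∈ s, δ ≤ dist (x i) a)
    (hsep : ∀ i ∈ s, ∀ j ∈ s, i ≠ j → δ ≤ dist (x i) (x j)) :
    ∑ i ∈ s, ((δ / dist (x i) a) ^ 2) ^ Module.finrank ℝ E ≤ 2 * 3 ^ Module.finrank ℝ E := by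
  set D := Module.finrank ℝ E
  have hsum := sum_inv_sq_le_of_card_le (A := 3 ^ D) (by positivity) s
    (fun i => (dist (x i) a / δ) ^ D)
    (fun i hi => one_le_pow₀ ((one_le_div hδ).mpr (ha i hi)))
    (fun i hi t ht htb => ?_)
  · push_cast at hsum
    convert hsum using 2 with i
    rw [← pow_mul, ← pow_mul, ← inv_pow, inv_div, mul_comm]
  · have hdi := ha i hi
    push_cast
    rcases Nat.eq_zero_or_pos D with hD | hD
    · have hE : Subsingleton E := Module.finrank_zero_iff.mp hD
      rw [Subsingleton.elim (x i) a, dist_self] at hdi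
      exact absurd hdi (not_le.mpr hδ)
    have hpack := card_mul_pow_le_of_separated t x a (R := dist (x i) a) hδ dist_nonneg
      (fun j hj => by
        have h := (pow_le_pow_iff_left₀ (by positivity) (by positivity) hD.ne').mp (htb j hj)
        rwa [div_le_div_iff_of_pos_right hδ] at h)
      (fun j hj k hk => hsep j (ht hj) k (ht hk))
    rw [← mul_pow]
    refine le_of_mul_le_mul_right (hpack.trans ?_) (pow_pos (half_pos hδ) D)
    rw [← mul_pow]
    gcongr
    field_simp
    linarith

/-- **Lemma 3.14.** Let `x_1,…,x_M ∈ S^{d−1}` be pairwise distinct with separation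
distance `min_{j≠ℓ} arccos(x_jᵀ x_ℓ) > q`. If `n > 2.5 π d / q`, then the evaluation map
sending each real polynomial of total degree at most `n` to `(p(x_1),…,p(x_M))` is
surjective onto `ℝ^M` (equivalently, the nonequispaced spherical Fourier matrix `Y_n`
has full rank `M`). -/
theorem sphere_evaluation_surjective_of_separation
    {d M : ℕ} (hd : 0 < d)
    (x : Fin M → Fin d → ℝ) (hsph : ∀ j, ∑ i, x j i ^ 2 = 1)
    (hdist : Function.Injective x)
    (q : ℝ) (hq : 0 < q)
    (hsep : ∀ j ℓ, j ≠ ℓ → q < Real.arccos (∑ i, x j i * x ℓ i))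
    (n : ℕ) (hn : 2.5 * Real.pi * d / q < n) :
    ∀ v : Fin M → ℝ, ∃ p : MvPolynomial (Fin d) ℝ,
      p.totalDegree ≤ n ∧ ∀ j, MvPolynomial.eval (x j) p = v j := by
  rcases Nat.lt_or_ge M 2 with hM | hM
  · intro v
    refine ⟨∑ j, MvPolynomial.C (v j), ?_, fun j => ?_⟩
    · exact MvPolynomial.totalDegree_finsetSum_le fun j _ => by simp
    · have : Subsingleton (Fin M) := Fin.subsingleton_iff_le_one.mpr (by omega)
      rw [map_sum, Fintype.sum_subsingleton _ j, MvPolynomial.eval_C]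
  have hπ := Real.pi_pos
  have hqπ : q ≤ Real.pi :=
    ((hsep ⟨0, by omega⟩ ⟨1, by omega⟩ (by simp)).trans_le (Real.arccos_le_pi _)).le
  set m := n / d + 1 with hm
  have hd' : (0 : ℝ) < d := by exact_mod_cast hd
  have hmq : 5 / 2 * Real.pi < m * q := by
    have h1 : n < d * m := Nat.lt_mul_div_succ n hd
    have h2 : (n : ℝ) < d * m := by exact_mod_cast h1
    rw [div_lt_iff₀ hq] at hn
    norm_num at hn
    have h3 : 5 / 2 * Real.pi * d < (m * q) * d := by nlinarith
    exact lt_of_mul_lt_mul_right h3 hd'.le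
  set δ := 2 * q / Real.pi with hδ
  have hδ0 : 0 < δ := by positivity
  have hmδ : 5 < m * δ := by
    rw [hδ, mul_div_assoc', lt_div_iff₀ hπ]
    linarith
  let y : Fin M → EuclideanSpace ℝ (Fin d) := fun j => WithLp.toLp 2 (x j)
  have hdistsq : ∀ j l, dist (y j) (y l) ^ 2 = 2 * (1 - ∑ i, x j i * x l i) := by
    intro j l
    rw [EuclideanSpace.dist_eq, Real.sq_sqrt (Finset.sum_nonneg fun i _ => sq_nonneg _)]
    have : ∀ i, dist (y j i) (y l i) ^ 2 = x j i ^ 2 + x l i ^ 2 - 2 * (x j i * x l i) := by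
      intro i
      rw [Real.dist_eq, sq_abs]
      simp only [y]
      ring
    simp only [this, Finset.sum_sub_distrib, Finset.sum_add_distrib, hsph, ← Finset.mul_sum]
    ring
  have hsepy : ∀ j l, j ≠ l → δ ≤ dist (y j) (y l) := by
    intro j l hjl
    have hcos : (∑ i, x j i * x l i) ≤ Real.cos q := by
      by_contra! hlt
      have := Real.arccos_le_arccos hlt.le
      rw [Real.arccos_cos hq.le hqπ] at this
      linarith [hsep j l hjl]
    have hquad := Real.cos_le_one_sub_mul_cos_sq (x := q) (by rwa [abs_of_pos hq])
    have hδsq : δ ^ 2 = 2 * (2 / Real.pi ^ 2 * q ^ 2) := by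
      rw [hδ]
      ring
    refine (sq_le_sq₀ hδ0.le dist_nonneg).mp ?_
    rw [hdistsq, hδsq]
    linarith
  have habs : ∀ j l, |∑ i, x j i * x l i| ≤ 1 := by
    intro j l
    have := Finset.sum_mul_sq_le_sq_mul_sq Finset.univ (x j) (x l)
    rw [hsph, hsph, one_mul] at this
    exact (sq_le_one_iff_abs_le_one _).mp this
  obtain ⟨Q, hQdeg, hQ1, hQ⟩ := exists_fejer_polynomial m
  refine exists_interpolant_of_diag_dominant x (Q ^ d) ?_ fun j => ?_
  · refine Polynomial.natDegree_pow_le.trans ((Nat.mul_le_mul_left d hQdeg).trans ?_)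
    simpa [hm] using Nat.mul_div_le n d
  have hm0 : (0 : ℝ) < m := by positivity
  have hdiag : ∑ i, x j i * x j i = 1 := by simpa [sq] using hsph j
  simp only [Polynomial.eval_pow, hdiag, hQ1, abs_pow]
  rw [abs_of_pos hm0]
  have hterm : ∀ l ∈ Finset.univ.erase j, |Q.eval (∑ i, x j i * x l i)| ^ d ≤
      ((m : ℝ) ^ 2) ^ d * (4 / 25) ^ d * ((δ / dist (y l) (y j)) ^ 2) ^ d := by
    intro l hl
    have hr : 0 < dist (y l) (y j) := hδ0.trans_le (hsepy l j (Finset.ne_of_mem_erase hl))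
    rw [← mul_pow, ← mul_pow]
    gcongr
    have h1 := hQ _ (habs j l)
    have h2 := hdistsq j l
    rw [dist_comm] at h2
    rw [div_pow, mul_div_assoc', le_div_iff₀ (by positivity)]
    have h3 : 25 ≤ (m * δ) ^ 2 := by nlinarith
    rw [h2]
    nlinarith
  have hsum := sum_div_dist_pow_le_of_separated (Finset.univ.erase j) y (y j) hδ0
    (fun l hl => hsepy l j (Finset.ne_of_mem_erase hl)) (fun l _ k _ hlk => hsepy l k hlk)
  rw [finrank_euclideanSpace_fin] at hsum
  have hsmall : (4 / 25 : ℝ) ^ d * (2 * 3 ^ d) < 1 := by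
    rw [mul_left_comm, ← mul_pow]
    have : (4 / 25 * 3 : ℝ) ^ d ≤ (4 / 25 * 3) ^ 1 :=
      pow_le_pow_of_le_one (by norm_num) (by norm_num) hd
    linarith
  calc _ ≤ ∑ l ∈ Finset.univ.erase j,
        ((m : ℝ) ^ 2) ^ d * (4 / 25) ^ d * ((δ / dist (y l) (y j)) ^ 2) ^ d :=
        Finset.sum_le_sum hterm
    _ ≤ ((m : ℝ) ^ 2) ^ d * (4 / 25) ^ d * (2 * 3 ^ d) := by
        rw [← Finset.mul_sum]
        gcongr
    _ = ((m : ℝ) ^ 2) ^ d * ((4 / 25) ^ d * (2 * 3 ^ d)) := by ring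
    _ < ((m : ℝ) ^ 2) ^ d := mul_lt_of_lt_one_right (by positivity) hsmall
end

section
/- Let x_1,…,x_M ∈ S^{d−1} be pairwise distinct with min_{j≠ℓ} arccos(x_jᵀ x_ℓ) > q, let a_1,…,a_M ∈ ℝ \ {0}, and let n ∈ ℕ satisfy n > 2.5π d / q + 1. Define the symmetric bilinear form B on real polynomials by B(p, r) = Σ_{j=1}^M a_j p(x_j) r(x_j). Then {x_1,…,x_M} = { x ∈ S^{d−1} : p(x) = 0 for every polynomial p of total degree at most n with B(p, r) = 0 for all polynomials r of total degree at most n }; equivalently, with Ω = {x_1,…,x_M}, Ω = V_{S^{d−1}}(ker H̃_n) for the moment matrix H̃_n = Y_nᵀ diag(a_1,…,a_M) Y_n of the signed Dirac ensemble Σ_j a_j δ_{x_j}. -/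
/-- Volume bound: points of norm at most `R` with pairwise distances at least `1` number at most
`(2 * R + 1) ^ dim`. -/
theorem card_le_of_separated_of_norm_le {E : Type*} [NormedAddCommGroup E] [NormedSpace ℝ E]
    [FiniteDimensional ℝ E] {R : ℝ} (hR : 0 ≤ R) (s : Finset E) (hs : ∀ c ∈ s, ‖c‖ ≤ R)
    (h : ∀ c ∈ s, ∀ e ∈ s, c ≠ e → 1 ≤ ‖c - e‖) :
    (s.card : ℝ) ≤ (2 * R + 1) ^ Module.finrank ℝ E := by
  borelize E
  let μ : MeasureTheory.Measure E := MeasureTheory.Measure.addHaar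
  have hρ : 0 < R + 1 / 2 := by positivity
  have hdisj : Set.Pairwise (s : Set E)
      (Function.onFun Disjoint fun c => Metric.ball c (1 / 2 : ℝ)) := by
    intro c hc e he hce
    apply Metric.ball_disjoint_ball
    rw [dist_eq_norm, add_halves]
    exact h c hc e he hce
  have hsub : (⋃ c ∈ s, Metric.ball c (1 / 2 : ℝ)) ⊆ Metric.ball (0 : E) (R + 1 / 2) := by
    refine Set.iUnion₂_subset fun c hc => Metric.ball_subset_ball' ?_
    rw [dist_zero_right]
    linarith [hs c hc]
  have hμ : (s.card : ENNReal) * ENNReal.ofReal ((1 / 2 : ℝ) ^ Module.finrank ℝ E) *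
        μ (Metric.ball 0 1) ≤
      ENNReal.ofReal ((R + 1 / 2) ^ Module.finrank ℝ E) * μ (Metric.ball 0 1) := by
    have hhalf : (0 : ℝ) < 1 / 2 := by norm_num
    have hle := MeasureTheory.measure_mono (μ := μ) hsub
    rw [MeasureTheory.measure_biUnion_finset hdisj fun c _ => measurableSet_ball] at hle
    simp only [μ.addHaar_ball_of_pos _ hhalf, μ.addHaar_ball_of_pos _ hρ, Finset.sum_const,
      nsmul_eq_mul, ← mul_assoc] at hle
    exact hle
  have hcard := (ENNReal.mul_le_mul_iff_left
    (Metric.measure_ball_pos μ 0 zero_lt_one).ne' MeasureTheory.measure_ball_lt_top.ne).1 hμ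
  have hreal := ENNReal.toReal_le_of_le_ofReal (pow_nonneg hρ.le _) hcard
  rw [ENNReal.toReal_mul, ENNReal.toReal_natCast, ENNReal.toReal_ofReal (by positivity)] at hreal
  calc (s.card : ℝ)
      = (s.card * (1 / 2) ^ Module.finrank ℝ E) * 2 ^ Module.finrank ℝ E := by
        rw [mul_assoc, ← mul_pow]; norm_num
    _ ≤ (R + 1 / 2) ^ Module.finrank ℝ E * 2 ^ Module.finrank ℝ E := by gcongr
    _ = (2 * R + 1) ^ Module.finrank ℝ E := by rw [← mul_pow]; ring_nf

/-- In dimension at least `2`, the inverse powers `‖c‖ ^ (-2 dim)` of `1`-separated points outside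
the open unit ball sum to less than `(25 / 4) ^ dim`. -/
theorem sum_inv_norm_pow_lt_one_of_separated {E : Type*} [NormedAddCommGroup E] [NormedSpace ℝ E]
    [FiniteDimensional ℝ E] (hE : 2 ≤ Module.finrank ℝ E) (s : Finset E)
    (hs : ∀ c ∈ s, 1 ≤ ‖c‖) (h : ∀ c ∈ s, ∀ e ∈ s, c ≠ e → 1 ≤ ‖c - e‖) :
    ∑ c ∈ s, (4 / 25 / ‖c‖ ^ 2) ^ Module.finrank ℝ E < 1 := by
  classical
  have hnear : ∀ c : E, ∃ k : ℕ, c ∈ s → 2 ^ k ≤ ‖c‖ ∧ ‖c‖ < 2 ^ (k + 1) := by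
    intro c
    by_cases hc : c ∈ s
    · obtain ⟨k, hk⟩ := exists_nat_pow_near (hs c hc) (one_lt_two : (1 : ℝ) < 2)
      exact ⟨k, fun _ => hk⟩
    · exact ⟨0, fun h => absurd h hc⟩
  choose κ hκ using hnear
  have hshell : ∀ k : ℕ, ∑ c ∈ s with κ c = k, (4 / 25 / ‖c‖ ^ 2) ^ Module.finrank ℝ E ≤
      16 / 25 * (1 / 4) ^ k := by
    intro k
    have hcard : ((s.filter fun c => κ c = k).card : ℝ) ≤ (5 * 2 ^ k) ^ Module.finrank ℝ E := by
      refine (card_le_of_separated_of_norm_le (R := 2 ^ (k + 1)) (by positivity) _ ?_ ?_).trans ?_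
      · intro c hc
        obtain ⟨hcs, rfl⟩ := Finset.mem_filter.1 hc
        exact (hκ c hcs).2.le
      · intro c hc e he
        exact h c (Finset.mem_filter.1 hc).1 e (Finset.mem_filter.1 he).1
      · gcongr
        have : (1 : ℝ) ≤ 2 ^ k := one_le_pow₀ one_le_two
        rw [pow_succ]
        linarith
    calc ∑ c ∈ s with κ c = k, (4 / 25 / ‖c‖ ^ 2) ^ Module.finrank ℝ E
        ≤ ∑ c ∈ s with κ c = k, (4 / 25 / (2 ^ k) ^ 2 : ℝ) ^ Module.finrank ℝ E := by
          refine Finset.sum_le_sum fun c hc => ?_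
          obtain ⟨hcs, rfl⟩ := Finset.mem_filter.1 hc
          gcongr
          exact (hκ c hcs).1
      _ ≤ (5 * 2 ^ k) ^ Module.finrank ℝ E * (4 / 25 / (2 ^ k) ^ 2) ^ Module.finrank ℝ E := by
          rw [Finset.sum_const, nsmul_eq_mul]
          gcongr
      _ = (4 / 5 / 2 ^ k) ^ Module.finrank ℝ E := by
          rw [← mul_pow]
          congr 1
          field_simp
          norm_num
      _ ≤ (4 / 5 / 2 ^ k) ^ 2 := by
          refine pow_le_pow_of_le_one (by positivity) ?_ hE
          rw [div_le_one (by positivity)]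
          have : (1 : ℝ) ≤ 2 ^ k := one_le_pow₀ one_le_two
          linarith
      _ = 16 / 25 * (1 / 4) ^ k := by
          rw [div_pow, ← pow_mul, mul_comm k 2, pow_mul, one_div_pow]
          norm_num
          ring
  have hgeom : HasSum (fun k : ℕ => (16 / 25 * (1 / 4) ^ k : ℝ)) (16 / 25 * (1 - 1 / 4)⁻¹) :=
    (hasSum_geometric_of_lt_one (by norm_num) (by norm_num)).mul_left _
  calc ∑ c ∈ s, (4 / 25 / ‖c‖ ^ 2) ^ Module.finrank ℝ E
      = ∑ k ∈ s.image κ, ∑ c ∈ s with κ c = k, (4 / 25 / ‖c‖ ^ 2) ^ Module.finrank ℝ E :=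
        (Finset.sum_fiberwise_of_maps_to (fun c hc => Finset.mem_image_of_mem κ hc) _).symm
    _ ≤ ∑ k ∈ s.image κ, (16 / 25 * (1 / 4) ^ k : ℝ) := Finset.sum_le_sum fun k _ => hshell k
    _ ≤ 16 / 25 * (1 - 1 / 4)⁻¹ := sum_le_hasSum _ (fun k _ => by positivity) hgeom
    _ < 1 := by norm_num

/-- A normalized Fejér-type polynomial: degree less than `N`, value `1` at `1`, and decay
`2 / (N ^ 2 * (1 - t))` on `[-1, 1)`. -/
theorem exists_polynomial_eval_one_eq_one_abs_eval_le {N : ℕ} (hN : 0 < N) :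
    ∃ F : Polynomial ℝ, F.natDegree ≤ N - 1 ∧ F.eval 1 = 1 ∧
      ∀ t : ℝ, |t| ≤ 1 → t < 1 → |F.eval t| ≤ 2 / (N ^ 2 * (1 - t)) := by
  have hN' : (N : ℝ) ≠ 0 := by positivity
  have hroot : (Polynomial.Chebyshev.T ℝ N - 1).IsRoot 1 := by simp
  obtain ⟨G, hG⟩ := Polynomial.dvd_iff_isRoot.2 hroot
  have hG1 : G.eval 1 = (N : ℝ) ^ 2 := by
    have := congrArg (fun P => (Polynomial.derivative P).eval 1) hG
    simpa [Polynomial.Chebyshev.derivative_T_eval_one] using this.symm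
  have hGdeg : G.natDegree ≤ N - 1 := by
    have hG0 : G ≠ 0 := by
      rintro rfl
      exact hN' (by simpa using hG1.symm)
    have hdeg := congrArg Polynomial.natDegree hG
    rw [Polynomial.natDegree_mul (Polynomial.X_sub_C_ne_zero 1) hG0,
      Polynomial.natDegree_X_sub_C] at hdeg
    have hle : (Polynomial.Chebyshev.T ℝ N - 1).natDegree ≤ N :=
      (Polynomial.natDegree_sub_le _ _).trans (by simp [Polynomial.Chebyshev.natDegree_T])
    omega
  refine ⟨Polynomial.C ((N : ℝ) ^ 2)⁻¹ * G, (Polynomial.natDegree_C_mul_le _ _).trans hGdeg,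
    by simp [hG1, hN'], fun t ht ht1 => ?_⟩
  have hpos : 0 < 1 - t := by linarith
  have heval : (Polynomial.Chebyshev.T ℝ N).eval t - 1 = (t - 1) * G.eval t := by
    simpa using congrArg (Polynomial.eval t) hG
  have hT := Polynomial.Chebyshev.abs_eval_T_real_le_one (N : ℤ) ht
  have hbound : (1 - t) * |G.eval t| ≤ 2 := by
    rw [← abs_of_pos hpos, ← abs_mul, abs_le]
    rw [abs_le] at hT
    constructor <;> linarith [hT.1, hT.2]
  rw [Polynomial.eval_mul, Polynomial.eval_C, abs_mul, abs_of_pos (by positivity),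
    le_div_iff₀ (by positivity)]
  calc ((N : ℝ) ^ 2)⁻¹ * |G.eval t| * (N ^ 2 * (1 - t)) = (1 - t) * |G.eval t| := by
        field_simp
    _ ≤ 2 := hbound

theorem MvPolynomial.totalDegree_polynomial_aeval_le {σ R : Type*} [CommSemiring R]
    (K : Polynomial R) (L : MvPolynomial σ R) :
    (Polynomial.aeval L K).totalDegree ≤ K.natDegree * L.totalDegree := by
  rw [Polynomial.aeval_eq_sum_range]
  refine totalDegree_finsetSum_le fun i hi => ?_
  refine (totalDegree_smul_le _ _).trans ((totalDegree_pow _ _).trans ?_)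
  gcongr
  exact Nat.lt_succ_iff.1 (Finset.mem_range.1 hi)

/-- The matrix of a zonal kernel being strictly diagonally dominant yields Lagrange polynomials. -/
theorem exists_lagrange_of_zonal_dominant {d M m : ℕ} (x : Fin M → Fin d → ℝ)
    (K : Polynomial ℝ) (hK : K.natDegree ≤ m)
    (hdom : ∀ j, ∑ k ∈ Finset.univ.erase j, |K.eval (∑ i, x j i * x k i)| <
      |K.eval (∑ i, x j i * x j i)|) (j : Fin M) :
    ∃ p : MvPolynomial (Fin d) ℝ, p.totalDegree ≤ m ∧
      ∀ k, MvPolynomial.eval (x k) p = if k = j then 1 else 0 := by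
  let A : Matrix (Fin M) (Fin M) ℝ := Matrix.of fun l k => K.eval (∑ i, x l i * x k i)
  have hA : A.det ≠ 0 := det_ne_zero_of_sum_row_lt_diag fun k => by simpa [A] using hdom k
  have hinv : A * A⁻¹ = 1 := Matrix.mul_nonsing_inv A (isUnit_iff_ne_zero.2 hA)
  let L : Fin M → MvPolynomial (Fin d) ℝ := fun k => ∑ i, x k i • MvPolynomial.X i
  have hL : ∀ k, (L k).totalDegree ≤ 1 := fun k =>
    MvPolynomial.totalDegree_finsetSum_le fun i _ =>
      (MvPolynomial.totalDegree_smul_le _ _).trans (MvPolynomial.totalDegree_X i).le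
  refine ⟨∑ k, A⁻¹ k j • Polynomial.aeval (L k) K, ?_, fun l => ?_⟩
  · refine MvPolynomial.totalDegree_finsetSum_le fun k _ =>
      (MvPolynomial.totalDegree_smul_le _ _).trans ?_
    refine (MvPolynomial.totalDegree_polynomial_aeval_le _ _).trans ?_
    simpa using Nat.mul_le_mul hK (hL k)
  · have heval : ∀ k, MvPolynomial.eval (x l) (Polynomial.aeval (L k) K) = A l k := by
      intro k
      have h := Polynomial.aeval_algHom_apply (MvPolynomial.aeval (R := ℝ) (x l)) (L k) K
      rw [MvPolynomial.aeval_eq_eval] at h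
      rw [← h]
      simp [A, L, MvPolynomial.smul_eval, mul_comm]
    have hentry := congrFun (congrFun hinv l) j
    rw [Matrix.mul_apply, Matrix.one_apply] at hentry
    rw [map_sum, ← hentry]
    exact Finset.sum_congr rfl fun k _ => by rw [MvPolynomial.smul_eval, heval, mul_comm]

/-- Points of the sphere at angular distance more than `q` are at squared chordal distance
more than `(2 * q / π) ^ 2`. -/
theorem sq_lt_two_sub_two_mul_of_lt_arccos {q t : ℝ} (hq : 0 < q) (ht : |t| ≤ 1)
    (h : q < Real.arccos t) : (2 * q / Real.pi) ^ 2 < 2 - 2 * t := by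
  have hπ := Real.pi_pos
  have hcos := Real.cos_le_one_sub_mul_cos_sq (x := Real.arccos t)
    (by rw [abs_of_nonneg (Real.arccos_nonneg t)]; exact Real.arccos_le_pi t)
  rw [Real.cos_arccos (abs_le.1 ht).1 (abs_le.1 ht).2] at hcos
  have hsq : 2 / Real.pi ^ 2 * q ^ 2 < 2 / Real.pi ^ 2 * Real.arccos t ^ 2 := by gcongr
  have : (2 * q / Real.pi) ^ 2 = 2 * (2 / Real.pi ^ 2 * q ^ 2) := by ring
  linarith

/-- Lagrange polynomials of degree `m > 2.5 π d / q` exist for `q`-separated points of the sphere. -/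
theorem exists_lagrange_of_separated {d M m : ℕ} (hd : 2 ≤ d)
    (x : Fin M → Fin d → ℝ) (hsph : ∀ j, ∑ i, x j i ^ 2 = 1) {q : ℝ} (hq : 0 < q)
    (hsep : ∀ j ℓ, j ≠ ℓ → q < Real.arccos (∑ i, x j i * x ℓ i))
    (hm : 2.5 * Real.pi * d / q < m) (j : Fin M) :
    ∃ p : MvPolynomial (Fin d) ℝ, p.totalDegree ≤ m ∧
      ∀ k, MvPolynomial.eval (x k) p = if k = j then 1 else 0 := by
  have hπ := Real.pi_pos
  have hd0 : 0 < d := by omega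
  set N := m / d + 1 with hNdef
  have hN : 2.5 * Real.pi / q < N := by
    have h1 : (m : ℝ) < d * N := by exact_mod_cast Nat.lt_mul_div_succ m hd0
    have h2 : d * (2.5 * Real.pi / q) < d * (N : ℝ) := by
      calc d * (2.5 * Real.pi / q) = 2.5 * Real.pi * d / q := by ring
        _ < _ := hm.trans h1
    exact lt_of_mul_lt_mul_left h2 (by positivity)
  obtain ⟨F, hFdeg, hF1, hF⟩ := exists_polynomial_eval_one_eq_one_abs_eval_le (Nat.succ_pos (m / d))
  set δ : ℝ := 2 * q / Real.pi with hδdef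
  have hδ : 0 < δ := by positivity
  have hNδ : 5 < N * δ := by
    rw [div_lt_iff₀ hq] at hN
    rw [hδdef, mul_div_assoc', lt_div_iff₀ hπ]
    linarith
  let z : Fin M → EuclideanSpace ℝ (Fin d) := fun k => WithLp.toLp 2 (x k)
  have hz : ∀ k l, ‖z k - z l‖ ^ 2 = 2 - 2 * ∑ i, x k i * x l i := by
    intro k l
    rw [EuclideanSpace.real_norm_sq_eq]
    calc ∑ i, (x k i - x l i) ^ 2
        = ∑ i, x k i ^ 2 + ∑ i, x l i ^ 2 - 2 * ∑ i, x k i * x l i := by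
          rw [Finset.mul_sum, ← Finset.sum_add_distrib, ← Finset.sum_sub_distrib]
          exact Finset.sum_congr rfl fun i _ => by ring
      _ = _ := by rw [hsph, hsph]; ring
  have hinner : ∀ k l, |∑ i, x k i * x l i| ≤ 1 := by
    intro k l
    rw [← sq_le_one_iff_abs_le_one]
    calc (∑ i, x k i * x l i) ^ 2 ≤ (∑ i, x k i ^ 2) * ∑ i, x l i ^ 2 :=
          Finset.sum_mul_sq_le_sq_mul_sq _ _ _
      _ = 1 := by rw [hsph, hsph, one_mul]
  have hzsep : ∀ k l, k ≠ l → δ < ‖z k - z l‖ := by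
    intro k l hkl
    refine lt_of_pow_lt_pow_left₀ 2 (norm_nonneg _) ?_
    rw [hz]
    exact sq_lt_two_sub_two_mul_of_lt_arccos hq (hinner k l) (hsep k l hkl)
  have hzinj : Function.Injective z := by
    intro k l hkl
    by_contra hne
    have := hzsep k l hne
    rw [hkl, sub_self, norm_zero] at this
    exact this.not_gt hδ
  refine exists_lagrange_of_zonal_dominant x (F ^ d) ?_ (fun j => ?_) j
  · calc (F ^ d).natDegree ≤ d * F.natDegree := Polynomial.natDegree_pow_le
      _ ≤ d * (m / d) := Nat.mul_le_mul_left d (by simpa [hNdef] using hFdeg)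
      _ ≤ m := Nat.mul_div_le m d
  have hjj : ∑ i, x j i * x j i = 1 := by simpa only [sq] using hsph j
  rw [hjj, Polynomial.eval_pow, hF1, one_pow, abs_one]
  have hscaled : ∀ v : EuclideanSpace ℝ (Fin d), δ ≤ ‖v‖ → 1 ≤ ‖δ⁻¹ • v‖ := by
    intro v hv
    rw [norm_smul, Real.norm_of_nonneg (by positivity), inv_mul_eq_div]
    exact (one_le_div hδ).2 hv
  let w : Fin M → EuclideanSpace ℝ (Fin d) := fun k => δ⁻¹ • (z j - z k)
  have hw : Function.Injective w := fun k l hkl =>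
    hzinj (sub_right_injective (smul_right_injective _ (inv_ne_zero hδ.ne') hkl))
  have hsum := sum_inv_norm_pow_lt_one_of_separated (E := EuclideanSpace ℝ (Fin d)) (by simpa)
    ((Finset.univ.erase j).image w) (by
      simp only [Finset.forall_mem_image, Finset.mem_erase, Finset.mem_univ, and_true]
      exact fun k hk => hscaled _ (hzsep j k (Ne.symm hk)).le) (by
      simp only [Finset.forall_mem_image]
      intro k _ l _ hkl
      have hlk : l ≠ k := fun h => hkl (by rw [h])
      rw [← smul_sub, sub_sub_sub_cancel_left]
      exact hscaled _ (hzsep l k hlk).le)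
  rw [Finset.sum_image hw.injOn, finrank_euclideanSpace_fin] at hsum
  refine lt_of_le_of_lt (Finset.sum_le_sum fun k hk => ?_) hsum
  have hdist := hzsep j k (Finset.ne_of_mem_erase hk).symm
  have hpos : 0 < ‖z j - z k‖ := hδ.trans hdist
  have hnorm := hz j k
  have hlt : ∑ i, x j i * x k i < 1 := by
    have : 0 < ‖z j - z k‖ ^ 2 := by positivity
    linarith
  rw [Polynomial.eval_pow, abs_pow]
  refine pow_le_pow_left₀ (abs_nonneg _) ((hF _ (hinner j k) hlt).trans ?_) d
  have hwk : ‖w k‖ ^ 2 = ‖z j - z k‖ ^ 2 / δ ^ 2 := by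
    rw [norm_smul, Real.norm_of_nonneg (by positivity), mul_pow, inv_pow, inv_mul_eq_div]
  have hone : 1 - ∑ i, x j i * x k i = ‖z j - z k‖ ^ 2 / 2 := by linarith
  rw [hwk, hone, div_div_eq_mul_div, ← mul_div_assoc, div_div_eq_mul_div, ← div_div]
  gcongr
  rw [div_le_iff₀ (by positivity)]
  nlinarith

/-- On `S⁰ = {1, -1}` Lagrange polynomials of degree at most one exist. -/
theorem exists_lagrange_of_dim_one {M : ℕ} (x : Fin M → Fin 1 → ℝ)
    (hsph : ∀ j, ∑ i, x j i ^ 2 = 1) (hdist : Function.Injective x) (j : Fin M) :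
    ∃ p : MvPolynomial (Fin 1) ℝ, p.totalDegree ≤ 1 ∧
      ∀ k, MvPolynomial.eval (x k) p = if k = j then 1 else 0 := by
  have hx : ∀ k, x k 0 ^ 2 = 1 := fun k => by simpa using hsph k
  refine ⟨MvPolynomial.C (1 / 2) + (x j 0 / 2) • MvPolynomial.X 0, ?_, fun k => ?_⟩
  · refine (MvPolynomial.totalDegree_add _ _).trans (max_le (by simp) ?_)
    exact (MvPolynomial.totalDegree_smul_le _ _).trans (MvPolynomial.totalDegree_X _).le
  · simp only [map_add, MvPolynomial.eval_C, MvPolynomial.smul_eval, MvPolynomial.eval_X]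
    split_ifs with hkj
    · subst hkj
      linarith [hx k]
    · have hne : x k 0 ≠ x j 0 := fun h => hkj (hdist (funext fun i => by
        rw [Subsingleton.elim i 0, h]))
      have hneg : x k 0 = -x j 0 := by
        have hsq : x k 0 ^ 2 = x j 0 ^ 2 := by rw [hx, hx]
        exact (sq_eq_sq_iff_eq_or_eq_neg.1 hsq).resolve_left hne
      rw [hneg]
      linarith [hx j]

/-- If Lagrange polynomials of degree `m` exist for a finite family of points, then the polynomials
of degree at most `m + 1` vanishing on the family have no further common zeros. -/
theorem mem_range_of_forall_vanishing {d M m : ℕ} (x : Fin M → Fin d → ℝ)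
    (hlag : ∀ j, ∃ p : MvPolynomial (Fin d) ℝ, p.totalDegree ≤ m ∧
      ∀ k, MvPolynomial.eval (x k) p = if k = j then 1 else 0) (y : Fin d → ℝ)
    (hy : ∀ p : MvPolynomial (Fin d) ℝ, p.totalDegree ≤ m + 1 →
      (∀ k, MvPolynomial.eval (x k) p = 0) → MvPolynomial.eval y p = 0) :
    y ∈ Set.range x := by
  choose p hpdeg hp using hlag
  by_cases hpy : ∃ j, MvPolynomial.eval y (p j) ≠ 0
  · obtain ⟨j, hj⟩ := hpy
    refine ⟨j, funext fun i => ?_⟩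
    have h := hy ((MvPolynomial.X i - MvPolynomial.C (x j i)) * p j) ?_ fun k => ?_
    · simp only [map_mul, map_sub, MvPolynomial.eval_X, MvPolynomial.eval_C] at h
      exact (sub_eq_zero.1 ((mul_eq_zero.1 h).resolve_right hj)).symm
    · refine (MvPolynomial.totalDegree_mul _ _).trans ?_
      rw [add_comm]
      refine add_le_add (hpdeg j) ((MvPolynomial.totalDegree_sub_C_le _ _).trans ?_)
      exact (MvPolynomial.totalDegree_X i).le
    · by_cases hkj : k = j
      · simp [hkj]
      · simp [hp, hkj]
  · push Not at hpy
    exfalso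
    have h := hy (1 - ∑ j, p j) ?_ fun k => ?_
    · simp [hpy] at h
    · refine (MvPolynomial.totalDegree_sub _ _).trans (max_le (by simp) ?_)
      exact MvPolynomial.totalDegree_finsetSum_le fun j _ => (hpdeg j).trans (Nat.le_succ m)
    · simp [hp]


/-- **Theorem 3.15.** Let `x_1,…,x_M ∈ S^{d−1}` be pairwise distinct and `q`-separated,
let `a_1,…,a_M ∈ ℝ \ {0}`, and let `n > 2.5 π d / q + 1`. With the bilinear form
`B(p,r) = ∑_j a_j p(x_j) r(x_j)`, the set `Ω = {x_1,…,x_M}` equals the set of points of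
the sphere at which every polynomial `p` of total degree at most `n` with `B(p,r) = 0`
for all polynomials `r` of total degree at most `n` vanishes; in matrix form,
`Ω = V_{S^{d−1}}(ker H̃_n)` for `H̃_n = Y_nᵀ diag(a) Y_n`. -/
theorem sphere_points_eq_zero_locus_of_moment_kernel
    {d M : ℕ} (hd : 0 < d)
    (x : Fin M → Fin d → ℝ) (hsph : ∀ j, ∑ i, x j i ^ 2 = 1)
    (hdist : Function.Injective x)
    (a : Fin M → ℝ) (ha : ∀ j, a j ≠ 0)
    (q : ℝ) (hq : 0 < q)
    (hsep : ∀ j ℓ, j ≠ ℓ → q < Real.arccos (∑ i, x j i * x ℓ i))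
    (n : ℕ) (hn : 2.5 * Real.pi * d / q + 1 < n) :
    Set.range x =
      {y : Fin d → ℝ | (∑ i, y i ^ 2 = 1) ∧
        ∀ p : MvPolynomial (Fin d) ℝ, p.totalDegree ≤ n →
          (∀ r : MvPolynomial (Fin d) ℝ, r.totalDegree ≤ n →
            ∑ j, a j * MvPolynomial.eval (x j) p * MvPolynomial.eval (x j) r = 0) →
          MvPolynomial.eval y p = 0} := by
  have hπ := Real.pi_pos
  have hn1 : 1 < n := by
    have : (1 : ℝ) < n := lt_of_le_of_lt (le_add_of_nonneg_left (by positivity)) hn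
    exact_mod_cast this
  obtain ⟨m, rfl⟩ : ∃ m, n = m + 1 := ⟨n - 1, by omega⟩
  have hm : 2.5 * Real.pi * d / q < m := by
    push_cast at hn
    linarith
  have hlag : ∀ j, ∃ p : MvPolynomial (Fin d) ℝ, p.totalDegree ≤ m ∧
      ∀ k, MvPolynomial.eval (x k) p = if k = j then 1 else 0 := by
    intro j
    obtain rfl | hd2 : d = 1 ∨ 2 ≤ d := by omega
    · obtain ⟨p, hpdeg, hp⟩ := exists_lagrange_of_dim_one x hsph hdist j
      exact ⟨p, hpdeg.trans (by omega), hp⟩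
    · exact exists_lagrange_of_separated hd2 x hsph hq hsep hm j
  ext y
  constructor
  · rintro ⟨j, rfl⟩
    refine ⟨hsph j, fun p _ hB => ?_⟩
    obtain ⟨r, hrdeg, hr⟩ := hlag j
    have h := hB r (hrdeg.trans (Nat.le_succ m))
    simp only [hr, mul_ite, mul_one, mul_zero, Finset.sum_ite_eq', Finset.mem_univ, if_true] at h
    exact (mul_eq_zero.1 h).resolve_left (ha j)
  · rintro ⟨-, hy⟩
    exact mem_range_of_forall_vanishing x hlag y fun p hpdeg hp =>
      hy p hpdeg fun r _ => by simp [hp]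
end
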